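/- Let C be a Möbius category and A a commutative ring. Let μ ∈ A⟦C⟧ satisfy μ(f) = 1 for every isomorphism f. Define ν ∈ A⟦C⟧ by the Möbius inversion formula ν(f) = Σ_{f = f_n ∘ ⋯ ∘ f_1} (−1)^n · μ(f_1) ⋯ μ(f_n), where the sum runs over isomorphism classes of factorizations of f into compositions of non-isomorphisms (with the unique empty factorization, contributing +1, when f is an isomorphism). Then μ * ν = ν * μ = δ, where δ is the convolution unit. -/

import Mathlib

open CategoryTheory

/-- A *Möbius category* is a small category `C` such that for every morphism `f : x ⟶ y`,
the category `Factorisation f` of factorizations `x → z → y` of `f` is equivalent to a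
finite partially ordered set. -/
def IsMobiusCategory (C : Type*) [Category C] : Prop :=
  ∀ ⦃x y : C⦄ (f : x ⟶ y), ∃ P : FinPartOrd.{0}, Nonempty (Factorisation f ≌ ↥P)

/-- A function on the morphisms of `C` descends to isomorphism classes of morphisms
(objects of the arrow category) iff it is invariant under isomorphisms of arrows.
Such invariant functions are exactly the elements of the Möbius algebra `A⟦C⟧`. -/
def ArrowInvariant {C : Type*} [Category C] {A : Type*}
    (μ : ∀ ⦃x y : C⦄, (x ⟶ y) → A) : Prop :=
  ∀ ⦃x y x' y' : C⦄ (f : x ⟶ y) (f' : x' ⟶ y') (ex : x ≅ x') (ey : y ≅ y'),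
    f ≫ ey.hom = ex.hom ≫ f' → μ f = μ f'

/-- Isomorphism relation on the factorization category `C_f`. -/
def FactIsoRel {C : Type*} [Category C] {x y : C} (f : x ⟶ y) :
    Factorisation f → Factorisation f → Prop :=
  fun F G => Nonempty (F ≅ G)

/-- The Möbius convolution `(μ * ν)(f) = ∑_{f = h ∘ g} μ(g) · ν(h)`, the sum running over the
isomorphism classes of factorizations of `f` (the elements of the poset `C_f`); for each class
a representative is chosen by `Quot.out`. -/
noncomputable def mobiusConv {C : Type*} [Category C] {A : Type*} [CommRing A]
    (μ ν : ∀ ⦃x y : C⦄, (x ⟶ y) → A) : ∀ ⦃x y : C⦄, (x ⟶ y) → A :=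
  fun _ _ f => ∑ᶠ q : Quot (FactIsoRel f), μ (Quot.out q).ι * ν (Quot.out q).π

open Classical in
/-- The convolution unit `δ`, taking value `1` on isomorphisms and `0` otherwise. -/
noncomputable def mobiusDelta (C : Type*) [Category C] (A : Type*) [CommRing A] :
    ∀ ⦃x y : C⦄, (x ⟶ y) → A :=
  fun _ _ f => if IsIso f then 1 else 0
/-- The `i`-th elementary step of a chain `F : Fin (n+1) ⥤ C`. -/
def chainStep {C : Type*} [Category C] {n : ℕ} (F : Fin (n + 1) ⥤ C) (i : Fin n) :
    F.obj i.castSucc ⟶ F.obj i.succ :=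
  F.map (homOfLE (Fin.castSucc_le_succ i))

/-- A factorization of `f : x ⟶ y` into a composition of `n` non-isomorphisms,
encoded as a functor from the linear order `Fin (n+1)` whose endpoints are `x` and `y`,
whose total composite is `f`, and whose elementary steps are all non-isomorphisms. -/
structure NonIsoChain {C : Type*} [Category C] {x y : C} (f : x ⟶ y) (n : ℕ) where
  F : Fin (n + 1) ⥤ C
  hx : F.obj 0 = x
  hy : F.obj (Fin.last n) = y
  fac : eqToHom hx.symm ≫ F.map (homOfLE (Fin.zero_le (Fin.last n))) ≫ eqToHom hy = f
  nonIso : ∀ i : Fin n, ¬ IsIso (chainStep F i)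

/-- Two factorizations into non-isomorphisms are isomorphic if they differ by isomorphisms
of the intermediate objects compatible with the structure maps (i.e. there is a natural
isomorphism of the underlying functors which is the identity at the endpoints). -/
def ChainIsoRel {C : Type*} [Category C] {x y : C} (f : x ⟶ y) (n : ℕ) :
    NonIsoChain f n → NonIsoChain f n → Prop :=
  fun F G => ∃ e : F.F ≅ G.F,
    e.hom.app 0 = eqToHom (F.hx.trans G.hx.symm) ∧
    e.hom.app (Fin.last n) = eqToHom (F.hy.trans G.hy.symm)


/-- The weight `(−1)^n · μ(f₁) ⋯ μ(f_n)` of a factorization of a morphism into `n`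
non-isomorphisms. -/
noncomputable def chainWeight {C : Type*} [Category C] {A : Type*} [CommRing A]
    (μ : ∀ ⦃x y : C⦄, (x ⟶ y) → A) {x y : C} {f : x ⟶ y} {n : ℕ}
    (ch : NonIsoChain f n) : A :=
  (-1 : A) ^ n * ∏ i : Fin n, μ (chainStep ch.F i)

open Classical in
/-- The Möbius inversion formula: `ν(f) = ∑_{f = f_n ∘ ⋯ ∘ f_1} (−1)^n · μ(f₁) ⋯ μ(f_n)`,
summing over isomorphism classes of factorizations of `f` into compositions of
non-isomorphisms.  When `f` is an isomorphism, the unique empty factorization contributes `+1`. -/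
noncomputable def mobiusInv {C : Type*} [Category C] {A : Type*} [CommRing A]
    (μ : ∀ ⦃x y : C⦄, (x ⟶ y) → A) : ∀ ⦃x y : C⦄, (x ⟶ y) → A :=
  fun _ _ f =>
    if IsIso f then 1
    else ∑ᶠ n : ℕ, ∑ᶠ q : Quot (ChainIsoRel f n), chainWeight μ (Quot.out q)

namespace MobiusAux

open Classical in
theorem matrix_pow_eq_sum_paths {P A : Type*} [Fintype P] [CommRing A]
    (M : Matrix P P A) (n : ℕ) : ∀ p q : P,
    (M ^ n) p q = ∑ c : Fin (n + 1) → P,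
      if c 0 = p ∧ c (Fin.last n) = q then ∏ i : Fin n, M (c i.castSucc) (c i.succ) else 0 := by
  induction n with
  | zero =>
    intro p q
    rw [← (Equiv.funUnique (Fin 1) P).symm.sum_comp]
    by_cases hpq : p = q
    · subst hpq
      simp
    · rw [pow_zero, Matrix.one_apply_ne hpq, Finset.sum_eq_zero]
      intro r _
      rw [if_neg]
      rintro ⟨h1, h2⟩
      exact hpq (h1.symm.trans h2)
  | succ n ih =>
    intro p q
    rw [pow_succ', Matrix.mul_apply, ← (Fin.consEquiv (fun _ : Fin (n + 2) => P)).sum_comp,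
      Fintype.sum_prod_type]
    symm
    rw [Finset.sum_eq_single p]
    · symm
      simp_rw [ih, Finset.mul_sum]
      rw [Finset.sum_comm]
      refine Finset.sum_congr rfl fun c _ => ?_
      rw [Finset.sum_eq_single (c 0)]
      · simp only [Fin.consEquiv, Equiv.coe_fn_mk, Fin.cons_zero, true_and, ← Fin.succ_last,
          Fin.cons_succ, Fin.prod_univ_succ, Fin.castSucc_zero, ← Fin.succ_castSucc, mul_ite,
          mul_zero]
      · intro r _ hr
        rw [if_neg (fun h => hr h.1.symm), mul_zero]
      · simp
    · intro r _ hr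
      apply Finset.sum_eq_zero
      intro c _
      rw [if_neg]
      rintro ⟨h, -⟩
      exact hr (by simpa [Fin.consEquiv] using h)
    · simp

open Classical in
theorem matrix_pow_eq_sum_chains {P A : Type*} [Fintype P] [PartialOrder P] [CommRing A]
    (M : Matrix P P A) (hM : ∀ p q, ¬ p < q → M p q = 0) (n : ℕ) (p q : P) :
    (M ^ n) p q = ∑ c : {c : Fin (n + 1) → P // c 0 = p ∧ c (Fin.last n) = q ∧ StrictMono c},
      ∏ i : Fin n, M (c.1 i.castSucc) (c.1 i.succ) := by
  rw [matrix_pow_eq_sum_paths, ← Finset.sum_filter]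
  symm
  rw [← Finset.sum_subtype
    (Finset.univ.filter fun c : Fin (n + 1) → P => c 0 = p ∧ c (Fin.last n) = q ∧ StrictMono c)
    (by simp) (fun c => ∏ i : Fin n, M (c i.castSucc) (c i.succ))]
  apply Finset.sum_subset
  · intro c
    simp only [Finset.mem_filter, Finset.mem_univ, true_and]
    tauto
  · intro c h1 h2
    simp only [Finset.mem_filter, Finset.mem_univ, true_and] at h1 h2
    have h3 : ¬ StrictMono c := fun h => h2 ⟨h1.1, h1.2, h⟩
    rw [Fin.strictMono_iff_lt_succ] at h3
    push Not at h3
    obtain ⟨i, hi⟩ := h3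
    exact Finset.prod_eq_zero (Finset.mem_univ i) (hM _ _ hi)

open Classical in
theorem matrix_pow_zero_of_card {P A : Type*} [Fintype P] [PartialOrder P] [CommRing A]
    (M : Matrix P P A) (hM : ∀ p q, ¬ p < q → M p q = 0) (n : ℕ) (hn : Fintype.card P ≤ n) :
    M ^ n = 0 := by
  ext p q
  rw [matrix_pow_eq_sum_chains M hM]
  apply Finset.sum_eq_zero
  rintro ⟨c, -, -, hc⟩ -
  have := Fintype.card_le_of_injective c hc.injective
  simp at this
  omega

open Classical in
theorem matrix_pow_diag {P A : Type*} [Fintype P] [PartialOrder P] [CommRing A]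
    (M : Matrix P P A) (hM : ∀ p q, ¬ p < q → M p q = 0) (n : ℕ) (hn : n ≠ 0) (p : P) :
    (M ^ n) p p = 0 := by
  rw [matrix_pow_eq_sum_chains M hM]
  apply Finset.sum_eq_zero
  rintro ⟨c, h0, h1, hc⟩ -
  have : (0 : Fin (n + 1)) = Fin.last n := hc.injective (h0.trans h1.symm)
  simp [Fin.ext_iff] at this
  exact absurd this.symm hn

section

variable {C : Type*} [Category C] {A : Type*} [CommRing A]
  (μ : ∀ ⦃x y : C⦄, (x ⟶ y) → A) {x y : C} {f : x ⟶ y}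

theorem mk_le_mk {p q : Factorisation f} :
    ThinSkeleton.mk p ≤ ThinSkeleton.mk q ↔ Nonempty (p ⟶ q) := Iff.rfl

theorem mk_eq_mk {p q : Factorisation f} :
    ThinSkeleton.mk p = ThinSkeleton.mk q ↔ Nonempty (p ≅ q) :=
  ⟨fun h => Quotient.exact h, fun h => Quotient.sound h⟩

theorem mk_out (r : ThinSkeleton (Factorisation f)) :
    ThinSkeleton.mk (Quotient.out r) = r := Quotient.out_eq r

/-- Isomorphisms of factorisations have invertible underlying map. -/
def midIso {p q : Factorisation f} (e : p ≅ q) : p.mid ≅ q.mid := Factorisation.forget.mapIso e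

theorem iso_of_isIso {p q : Factorisation f} (h : p ⟶ q) (hh : IsIso h.h) : Nonempty (p ≅ q) := by
  refine ⟨⟨h, ⟨inv h.h, ?_, ?_⟩, ?_, ?_⟩⟩
  · rw [IsIso.comp_inv_eq, h.ι_h]
  · rw [IsIso.inv_comp_eq, h.h_π]
  · apply Factorisation.Hom.ext; simp
  · apply Factorisation.Hom.ext; simp

theorem isIso_of_iso [Quiver.IsThin (Factorisation f)] {p q : Factorisation f} (h : p ⟶ q)
    (e : p ≅ q) : IsIso h.h := by
  have : h = e.hom := Subsingleton.elim _ _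
  rw [this]
  exact (midIso e).isIso_hom

theorem isIso_iff [Quiver.IsThin (Factorisation f)] {p q : Factorisation f} (h : p ⟶ q) :
    IsIso h.h ↔ ThinSkeleton.mk p = ThinSkeleton.mk q := by
  rw [mk_eq_mk]
  exact ⟨fun hh => iso_of_isIso h hh, fun ⟨e⟩ => isIso_of_iso h e⟩

open Classical in
/-- The incidence matrix of `μ`. -/
noncomputable def W (f : x ⟶ y) :
    Matrix (ThinSkeleton (Factorisation f)) (ThinSkeleton (Factorisation f)) A :=
  fun r s => if h : Nonempty (Quotient.out r ⟶ Quotient.out s) then μ h.some.h else 0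

theorem W_mk [Quiver.IsThin (Factorisation f)] (hμ : ArrowInvariant μ) {p q : Factorisation f}
    (h : p ⟶ q) : W μ f (ThinSkeleton.mk p) (ThinSkeleton.mk q) = μ h.h := by
  obtain ⟨e⟩ := mk_eq_mk.1 (mk_out (ThinSkeleton.mk p))
  obtain ⟨e'⟩ := mk_eq_mk.1 (mk_out (ThinSkeleton.mk q))
  have hne : Nonempty (Quotient.out (ThinSkeleton.mk p) ⟶ Quotient.out (ThinSkeleton.mk q)) :=
    ⟨e.hom ≫ h ≫ e'.inv⟩
  rw [W, dif_pos hne]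
  refine hμ _ _ (midIso e) (midIso e') ?_
  exact congrArg Factorisation.Hom.h (Subsingleton.elim (hne.some ≫ e'.hom) (e.hom ≫ h))

theorem W_of_not_le {r s : ThinSkeleton (Factorisation f)} (h : ¬ r ≤ s) : W μ f r s = 0 := by
  rw [W, dif_neg]
  intro h'
  exact h (by rw [← mk_out r, ← mk_out s]; exact h')

open Classical in
/-- Minus the strict part of `W`. -/
noncomputable def M (f : x ⟶ y) :
    Matrix (ThinSkeleton (Factorisation f)) (ThinSkeleton (Factorisation f)) A :=
  1 - W μ f

theorem W_diag [Quiver.IsThin (Factorisation f)] (hμ : ArrowInvariant μ)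
    (hμ1 : ∀ ⦃x y : C⦄ (f : x ⟶ y), IsIso f → μ f = 1) (r : ThinSkeleton (Factorisation f)) :
    W μ f r r = 1 := by
  rw [← mk_out r, W_mk μ hμ (𝟙 _)]
  apply hμ1
  simp only [Factorisation.id_h]
  infer_instance

theorem M_zero [Quiver.IsThin (Factorisation f)] (hμ : ArrowInvariant μ)
    (hμ1 : ∀ ⦃x y : C⦄ (f : x ⟶ y), IsIso f → μ f = 1) (r s : ThinSkeleton (Factorisation f))
    (h : ¬ r < s) : M μ f r s = 0 := by
  classical
  by_cases hrs : r = s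
  · subst hrs
    simp [M, W_diag μ hμ hμ1]
  · have : ¬ r ≤ s := fun h' => h (lt_of_le_of_ne h' hrs)
    simp [M, W_of_not_le μ this, hrs, Matrix.one_apply]

theorem M_mk [Quiver.IsThin (Factorisation f)] (hμ : ArrowInvariant μ) {p q : Factorisation f}
    (h : p ⟶ q) (hh : ¬ IsIso h.h) :
    M μ f (ThinSkeleton.mk p) (ThinSkeleton.mk q) = - μ h.h := by
  classical
  rw [isIso_iff h] at hh
  simp only [M, Matrix.sub_apply, Matrix.one_apply_ne hh, W_mk μ hμ h, zero_sub]

/-- The objects of a chain, as factorisations of `f`. -/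
def chainObj {p q : Factorisation f} {h : p ⟶ q} {n : ℕ} (ch : NonIsoChain h.h n)
    (i : Fin (n + 1)) : Factorisation f where
  mid := ch.F.obj i
  ι := p.ι ≫ eqToHom ch.hx.symm ≫ ch.F.map (homOfLE (Fin.zero_le i))
  π := ch.F.map (homOfLE (Fin.le_last i)) ≫ eqToHom ch.hy ≫ q.π
  ι_π := by
    have h1 := ch.fac
    rw [← homOfLE_comp (Fin.zero_le i) (Fin.le_last i), Functor.map_comp] at h1
    have h2 : p.ι ≫ h.h ≫ q.π = f := by simp
    rw [← h1] at h2
    simpa using h2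

/-- The maps of a chain. -/
def chainMap {p q : Factorisation f} {h : p ⟶ q} {n : ℕ} (ch : NonIsoChain h.h n)
    {i j : Fin (n + 1)} (hij : i ≤ j) : chainObj ch i ⟶ chainObj ch j :=
  Factorisation.Hom.mk (ch.F.map (homOfLE hij))
    (by simp [chainObj, ← Functor.map_comp])
    (by simp [chainObj, ← Functor.map_comp_assoc])

theorem chainObj_zero {p q : Factorisation f} {h : p ⟶ q} {n : ℕ} (ch : NonIsoChain h.h n) :
    ∃ u : p ⟶ chainObj ch 0, u.h = eqToHom ch.hx.symm := by
  refine ⟨Factorisation.Hom.mk (eqToHom ch.hx.symm) ?_ ?_, rfl⟩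
  · have : ch.F.map (homOfLE (Fin.zero_le 0)) = 𝟙 _ := ch.F.map_id 0
    simp [chainObj, this]
  · have h1 := ch.fac
    have h2 : h.h ≫ q.π = p.π := by simp
    rw [← h1] at h2
    simpa [chainObj] using h2

theorem chainObj_last {p q : Factorisation f} {h : p ⟶ q} {n : ℕ} (ch : NonIsoChain h.h n) :
    ∃ u : chainObj ch (Fin.last n) ⟶ q, u.h = eqToHom ch.hy := by
  refine ⟨Factorisation.Hom.mk (eqToHom ch.hy) ?_ ?_, rfl⟩
  · have h1 := ch.fac
    have h2 : p.ι ≫ h.h = q.ι := by simp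
    rw [← h1] at h2
    simpa [chainObj] using h2
  · have : ch.F.map (homOfLE (Fin.le_last (Fin.last n))) = 𝟙 _ := ch.F.map_id _
    simp [chainObj, this]

/-- The classes of the objects of a chain. -/
def chainCls {p q : Factorisation f} {h : p ⟶ q} {n : ℕ} (ch : NonIsoChain h.h n)
    (i : Fin (n + 1)) : ThinSkeleton (Factorisation f) := ThinSkeleton.mk (chainObj ch i)

theorem chainCls_prop [Quiver.IsThin (Factorisation f)] {p q : Factorisation f} {h : p ⟶ q}
    {n : ℕ} (ch : NonIsoChain h.h n) :
    chainCls ch 0 = ThinSkeleton.mk p ∧ chainCls ch (Fin.last n) = ThinSkeleton.mk q ∧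
      StrictMono (chainCls ch) := by
  refine ⟨?_, ?_, ?_⟩
  · obtain ⟨u, hu⟩ := chainObj_zero ch
    refine ((isIso_iff u).1 ?_).symm
    rw [hu]
    exact (eqToIso ch.hx.symm).isIso_hom
  · obtain ⟨u, hu⟩ := chainObj_last ch
    refine ((isIso_iff u).1 ?_)
    rw [hu]
    exact (eqToIso ch.hy).isIso_hom
  · rw [Fin.strictMono_iff_lt_succ]
    intro i
    refine lt_of_le_of_ne ⟨chainMap ch (Fin.castSucc_le_succ i)⟩ fun he => ch.nonIso i ?_
    exact (isIso_iff (chainMap ch (Fin.castSucc_le_succ i))).2 he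

theorem chainWeight_eq [Quiver.IsThin (Factorisation f)] (hμ : ArrowInvariant μ)
    {p q : Factorisation f} {h : p ⟶ q} {n : ℕ} (ch : NonIsoChain h.h n) :
    chainWeight μ ch = ∏ i : Fin n, M μ f (chainCls ch i.castSucc) (chainCls ch i.succ) := by
  have : ∀ i : Fin n, M μ f (chainCls ch i.castSucc) (chainCls ch i.succ)
      = - μ (chainStep ch.F i) := fun i =>
    M_mk μ hμ (chainMap ch (Fin.castSucc_le_succ i)) (ch.nonIso i)
  simp only [this, chainWeight, Finset.prod_neg, Finset.card_univ, Fintype.card_fin]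

theorem chainCls_rel {p q : Factorisation f} {h : p ⟶ q}
    {n : ℕ} (ch ch' : NonIsoChain h.h n) (hr : ChainIsoRel h.h n ch ch') :
    chainCls ch = chainCls ch' := by
  obtain ⟨e, h0, h1⟩ := hr
  funext i
  refine mk_eq_mk.2 (iso_of_isIso
    (Factorisation.Hom.mk (e.hom.app i) ?_ ?_ : chainObj ch i ⟶ chainObj ch' i)
    (show IsIso (e.hom.app i) from inferInstance))
  · simp only [chainObj, Category.assoc, NatTrans.naturality]
    rw [h0, eqToHom_trans_assoc]
  · simp only [chainObj]
    rw [← NatTrans.naturality_assoc, h1, eqToHom_trans_assoc]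

theorem rel_of_chainCls [Quiver.IsThin (Factorisation f)] {p q : Factorisation f} {h : p ⟶ q}
    {n : ℕ} (ch ch' : NonIsoChain h.h n) (hr : chainCls ch = chainCls ch') :
    ChainIsoRel h.h n ch ch' := by
  have e : ∀ i, Nonempty (chainObj ch i ≅ chainObj ch' i) := fun i =>
    mk_eq_mk.1 (congrFun hr i)
  replace e := fun i => (e i).some
  refine ⟨NatIso.ofComponents (fun i => midIso (e i)) ?_, ?_, ?_⟩
  · intro i j g
    have : chainMap ch (leOfHom g) ≫ (e j).hom = (e i).hom ≫ chainMap ch' (leOfHom g) :=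
      Subsingleton.elim _ _
    exact congrArg Factorisation.Hom.h this
  · obtain ⟨u, hu⟩ := chainObj_zero ch
    obtain ⟨u', hu'⟩ := chainObj_zero ch'
    have h1 : u ≫ (e 0).hom = u' := Subsingleton.elim _ _
    have h2 : u.h ≫ (e 0).hom.h = u'.h := congrArg Factorisation.Hom.h h1
    rw [hu, hu'] at h2
    exact ((eqToHom_comp_iff ch.hx.symm _ _).1 h2).trans (eqToHom_trans _ _)
  · obtain ⟨u, hu⟩ := chainObj_last ch
    obtain ⟨u', hu'⟩ := chainObj_last ch'
    have h1 : (e _).hom ≫ u' = u := Subsingleton.elim _ _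
    have h2 : (e _).hom.h ≫ u'.h = u.h := congrArg Factorisation.Hom.h h1
    rw [hu, hu'] at h2
    exact ((comp_eqToHom_iff ch'.hy _ _).1 h2).trans (eqToHom_trans _ _)

theorem eqToHom_fact_h {a b : Factorisation f} (hab : a = b) :
    (eqToHom hab).h = eqToHom (congrArg Factorisation.mid hab) := by
  subst hab; rfl

theorem chainCls_surj [Quiver.IsThin (Factorisation f)] {p q : Factorisation f} (h : p ⟶ q)
    (hh : ¬ IsIso h.h) {n : ℕ} (c : Fin (n + 1) → ThinSkeleton (Factorisation f))
    (h0 : c 0 = ThinSkeleton.mk p) (h1 : c (Fin.last n) = ThinSkeleton.mk q) (hc : StrictMono c) :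
    ∃ ch : NonIsoChain h.h n, chainCls ch = c := by
  classical
  rw [isIso_iff] at hh
  obtain ⟨s, hs, hsp, hsq⟩ : ∃ s : ThinSkeleton (Factorisation f) → Factorisation f,
      (∀ r, ThinSkeleton.mk (s r) = r) ∧ s (ThinSkeleton.mk p) = p ∧
        s (ThinSkeleton.mk q) = q := by
    refine ⟨fun r => if r = ThinSkeleton.mk p then p else if r = ThinSkeleton.mk q then q
      else Quotient.out r, ?_, ?_, ?_⟩
    · intro r
      dsimp only
      split_ifs with ha hb
      · exact ha.symm
      · exact hb.symm
      · exact mk_out r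
    · simp
    · simp [Ne.symm hh]
  have hm : ∀ i j : Fin (n + 1), i ≤ j → Nonempty (s (c i) ⟶ s (c j)) := by
    intro i j hij
    rw [← mk_le_mk, hs, hs]
    exact hc.monotone hij
  let G : Fin (n + 1) ⥤ Factorisation f :=
    { obj := fun i => s (c i)
      map := fun g => (hm _ _ (leOfHom g)).some
      map_id := fun _ => Subsingleton.elim _ _
      map_comp := fun _ _ => Subsingleton.elim _ _ }
  have e0 : G.obj 0 = p := by change s (c 0) = p; rw [h0, hsp]
  have e1 : G.obj (Fin.last n) = q := by change s (c _) = q; rw [h1, hsq]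
  let ch : NonIsoChain h.h n :=
    { F := G ⋙ Factorisation.forget
      hx := congrArg Factorisation.mid e0
      hy := congrArg Factorisation.mid e1
      fac := by
        have h2 : eqToHom e0.symm ≫ G.map (homOfLE (Fin.zero_le (Fin.last n))) ≫ eqToHom e1 = h :=
          Subsingleton.elim _ _
        have h3 := congrArg Factorisation.Hom.h h2
        rw [Factorisation.comp_h, Factorisation.comp_h, eqToHom_fact_h, eqToHom_fact_h] at h3
        exact h3
      nonIso := by
        intro i hi
        have := (isIso_iff (G.map (homOfLE (Fin.castSucc_le_succ i)))).1 hi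
        simp only [G, hs] at this
        exact (Fin.castSucc_lt_succ (i := i)).ne (hc.injective this) }
  refine ⟨ch, ?_⟩
  funext i
  rw [← hs (c i)]
  refine (isIso_iff (Factorisation.Hom.mk (𝟙 (s (c i)).mid) ?_ ?_ : chainObj ch i ⟶ s (c i))).1
    (show IsIso (𝟙 (s (c i)).mid) from inferInstance)
  · have h2 := (eqToHom e0.symm ≫ G.map (homOfLE (Fin.zero_le i))).ι_h
    rw [Factorisation.comp_h, eqToHom_fact_h] at h2
    change (p.ι ≫ eqToHom _ ≫ (G.map (homOfLE (Fin.zero_le i))).h) ≫ 𝟙 _ = _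
    rw [Category.comp_id]
    exact h2
  · have h2 := (G.map (homOfLE (Fin.le_last i)) ≫ eqToHom e1).h_π
    rw [Factorisation.comp_h, eqToHom_fact_h, Category.assoc] at h2
    change 𝟙 _ ≫ _ = (G.map (homOfLE (Fin.le_last i))).h ≫ eqToHom _ ≫ q.π
    rw [Category.id_comp]
    exact h2.symm

open Classical in
theorem sum_chains [Quiver.IsThin (Factorisation f)] [Fintype (ThinSkeleton (Factorisation f))]
    (hμ : ArrowInvariant μ)
    (hμ1 : ∀ ⦃x y : C⦄ (f : x ⟶ y), IsIso f → μ f = 1)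
    {p q : Factorisation f} (h : p ⟶ q) (hh : ¬ IsIso h.h) (n : ℕ) :
    ∑ᶠ t : Quot (ChainIsoRel h.h n), chainWeight μ (Quot.out t)
      = (M μ f ^ n) (ThinSkeleton.mk p) (ThinSkeleton.mk q) := by
  rw [matrix_pow_eq_sum_chains _ (M_zero μ hμ hμ1), ← finsum_eq_sum_of_fintype]
  refine finsum_eq_of_bijective
    (fun t => ⟨chainCls (Quot.out t), chainCls_prop (Quot.out t)⟩) ⟨?_, ?_⟩ ?_
  · intro t t' htt
    have := rel_of_chainCls _ _ (congrArg Subtype.val htt)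
    rw [← Quot.out_eq t, ← Quot.out_eq t']
    exact Quot.sound this
  · rintro ⟨c, h0, h1, hc⟩
    obtain ⟨ch, hch⟩ := chainCls_surj h hh c h0 h1 hc
    refine ⟨Quot.mk _ ch, Subtype.ext ?_⟩
    change chainCls (Quot.out (Quot.mk _ ch)) = c
    rw [← hch]
    exact congrArg (Quot.lift chainCls chainCls_rel) (Quot.out_eq (Quot.mk _ ch))
  · intro t
    exact chainWeight_eq μ hμ _

open Classical in
theorem mobiusInv_eq [Quiver.IsThin (Factorisation f)]
    [Fintype (ThinSkeleton (Factorisation f))]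
    (hμ : ArrowInvariant μ)
    (hμ1 : ∀ ⦃x y : C⦄ (f : x ⟶ y), IsIso f → μ f = 1)
    {p q : Factorisation f} (h : p ⟶ q) :
    mobiusInv μ h.h = (∑ n ∈ Finset.range (Fintype.card (ThinSkeleton (Factorisation f))),
      M μ f ^ n) (ThinSkeleton.mk p) (ThinSkeleton.mk q) := by
  rw [mobiusInv, Matrix.sum_apply]
  split_ifs with hh
  · rw [(isIso_iff h).1 hh, Finset.sum_eq_single 0]
    · simp
    · intro n _ hn
      exact matrix_pow_diag _ (M_zero μ hμ hμ1) n hn _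
    · intro h0
      have : 0 < Fintype.card (ThinSkeleton (Factorisation f)) :=
        Fintype.card_pos_iff.2 ⟨ThinSkeleton.mk p⟩
      simp at h0
      omega
  · simp_rw [sum_chains μ hμ hμ1 h hh]
    apply finsum_eq_sum_of_support_subset
    intro n hn
    by_contra hn'
    simp only [Finset.coe_range, Set.mem_Iio, not_lt] at hn'
    apply hn
    exact congrFun (congrFun (matrix_pow_zero_of_card _ (M_zero μ hμ hμ1) n hn') _) _

theorem thin_of (hC : IsMobiusCategory C) (f : x ⟶ y) : Quiver.IsThin (Factorisation f) := by
  obtain ⟨P, ⟨e⟩⟩ := hC f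
  intro a b
  exact ⟨fun u v => e.functor.map_injective (Subsingleton.elim _ _)⟩

theorem finite_of (hC : IsMobiusCategory C) (f : x ⟶ y) :
    Finite (ThinSkeleton (Factorisation f)) := by
  obtain ⟨P, ⟨e⟩⟩ := hC f
  refine Finite.of_injective (β := P) (fun r => e.functor.obj (Quotient.out r)) ?_
  intro r s hrs
  rw [← mk_out r, ← mk_out s]
  exact mk_eq_mk.2 ⟨e.functor.preimageIso (eqToIso hrs)⟩

end

end MobiusAux

/-- In a Möbius category, if `μ` takes value `1` on all isomorphisms, then the element `ν`
defined by the Möbius inversion formula is a two-sided convolution inverse of `μ`: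
`μ * ν = ν * μ = δ`. -/
theorem mobiusInv_is_convolution_inverse {C : Type*} [Category C] {A : Type*} [CommRing A]
    (hC : IsMobiusCategory C) (μ : ∀ ⦃x y : C⦄, (x ⟶ y) → A) (hμ : ArrowInvariant μ)
    (hμ1 : ∀ ⦃x y : C⦄ (f : x ⟶ y), IsIso f → μ f = 1) :
    ∀ ⦃x y : C⦄ (f : x ⟶ y),
      mobiusConv μ (mobiusInv μ) f = mobiusDelta C A f ∧
      mobiusConv (mobiusInv μ) μ f = mobiusDelta C A f := by
  intro x y f
  classical
  have := MobiusAux.thin_of hC f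
  have := MobiusAux.finite_of hC f
  let : Fintype (ThinSkeleton (Factorisation f)) := Fintype.ofFinite _
  let I : Factorisation f := Factorisation.initial
  let T : Factorisation f := Factorisation.terminal
  let hI : ∀ d : Factorisation f, I ⟶ d := fun d => Factorisation.initialHom d
  let hT : ∀ d : Factorisation f, d ⟶ T := fun d => Factorisation.terminalHom d
  let N := Fintype.card (ThinSkeleton (Factorisation f))
  have hz : MobiusAux.M μ f ^ N = 0 :=
    MobiusAux.matrix_pow_zero_of_card _ (MobiusAux.M_zero μ hμ hμ1) N le_rfl
  have hW : MobiusAux.W μ f = 1 - MobiusAux.M μ f := by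
    rw [MobiusAux.M]
    simp
  have hδ : (1 : Matrix (ThinSkeleton (Factorisation f)) (ThinSkeleton (Factorisation f)) A)
      (ThinSkeleton.mk I) (ThinSkeleton.mk T) = mobiusDelta C A f := by
    rw [Matrix.one_apply, mobiusDelta]
    exact if_congr (MobiusAux.isIso_iff (hI T)).symm rfl rfl
  constructor
  · have h1 := mul_neg_geom_sum (MobiusAux.M μ f) N
    rw [hz, sub_zero, ← hW] at h1
    rw [← hδ, ← h1, Matrix.mul_apply, ← finsum_eq_sum_of_fintype]
    refine finsum_congr fun r => ?_
    have h2 := MobiusAux.W_mk μ hμ (hI (Quot.out r))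
    have h3 := MobiusAux.mobiusInv_eq μ hμ hμ1 (hT (Quot.out r))
    have h4 : ThinSkeleton.mk (Quot.out r) = (r : ThinSkeleton (Factorisation f)) := Quot.out_eq r
    rw [h4] at h2 h3
    exact (congrArg₂ (· * ·) h2 h3.symm).symm
  · have h1 := geom_sum_mul_neg (MobiusAux.M μ f) N
    rw [hz, sub_zero, ← hW] at h1
    rw [← hδ, ← h1, Matrix.mul_apply, ← finsum_eq_sum_of_fintype]
    refine finsum_congr fun r => ?_
    have h2 := MobiusAux.W_mk μ hμ (hT (Quot.out r))
    have h3 := MobiusAux.mobiusInv_eq μ hμ hμ1 (hI (Quot.out r))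
    have h4 : ThinSkeleton.mk (Quot.out r) = (r : ThinSkeleton (Factorisation f)) := Quot.out_eq r
    rw [h4] at h2 h3
    exact (congrArg₂ (· * ·) h3.symm h2).symm
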